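/- Let G ~ N_d(0,K) be independent of A, assume E[‖A‖_HS^8] < ∞ and ℙ(E) > 0, and let η ∈ [0,1]. Then for every i, j ∈ {1,2,3} and every integer k ≥ 1, ℙ(E)·E[ (g̃(A,η,G))^{−k}·(∂^i g̃/∂t^i)(A,η,G)·((∂^j g̃/∂t^j)(A,η,G))^k ] ≤ E[ (h_i(A,η,G))²·g(A,η,G)·1_E ]^{1/2} · E[ (h_j(A,η,G))^{2k}·g(A,η,G)·1_E ]^{1/2}. -/

import Mathlib

open MeasureTheory ProbabilityTheory Matrix

noncomputable section

/-- Euclidean norm on `Fin d → ℝ`. -/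
def euclNorm {d : ℕ} (x : Fin d → ℝ) : ℝ := Real.sqrt (∑ i, x i ^ 2)

/-- Hilbert–Schmidt norm of a matrix. -/
def hsNorm {d : ℕ} (M : Matrix (Fin d) (Fin d) ℝ) : ℝ := Real.sqrt (∑ i, ∑ j, M i j ^ 2)

/-- Operator norm of a matrix (w.r.t. the Euclidean norm). -/
def opNorm {d : ℕ} (M : Matrix (Fin d) (Fin d) ℝ) : ℝ :=
  sSup {r : ℝ | ∃ x : Fin d → ℝ, euclNorm x = 1 ∧ r = euclNorm (M.mulVec x)}

/-- Smallest eigenvalue of a symmetric matrix (as the infimum of the Rayleigh quotient). -/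
def lambdaMin {d : ℕ} (M : Matrix (Fin d) (Fin d) ℝ) : ℝ :=
  sInf {r : ℝ | ∃ x : Fin d → ℝ, euclNorm x = 1 ∧ r = x ⬝ᵥ M.mulVec x}

/-- Density of the centered Gaussian law `N_d(0, M)` on `ℝ^d`. -/
def gaussDensity {d : ℕ} (M : Matrix (Fin d) (Fin d) ℝ) (x : Fin d → ℝ) : ℝ :=
  (Real.sqrt ((2 * Real.pi) ^ d * M.det))⁻¹ * Real.exp (-(1/2) * (x ⬝ᵥ M⁻¹.mulVec x))

/-- The centered Gaussian law `N_d(0, M)` on `ℝ^d` (for `M` positive definite). -/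
def gaussLaw {d : ℕ} (M : Matrix (Fin d) (Fin d) ℝ) : Measure (Fin d → ℝ) :=
  volume.withDensity fun x => ENNReal.ofReal (gaussDensity M x)

/-- Relative entropy (Kullback–Leibler divergence) of `μ` with respect to `ν`. -/
def relEnt {E : Type*} [MeasurableSpace E] (μ ν : Measure E) : ℝ :=
  ∫ x, Real.log ((μ.rnDeriv ν x).toReal) ∂μ

/-- `F` is a centered, integrable random vector which is conditionally Gaussian with respect to
the σ-field `𝓕`, with conditional covariance matrix `A`. -/
def CondGaussian {Ω : Type*} [MeasurableSpace Ω] (P : Measure Ω) {d : ℕ}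
    (F : Ω → Fin d → ℝ) (𝓕 : MeasurableSpace Ω)
    (A : Ω → Matrix (Fin d) (Fin d) ℝ) : Prop :=
  Integrable F P ∧ (∫ ω, F ω ∂P) = 0 ∧
  (∀ ω, (A ω).PosSemidef) ∧
  Measurable[𝓕] (fun ω i j => A ω i j) ∧
  ∀ y : Fin d → ℝ,
    P[(fun ω => Complex.exp (Complex.I * ((y ⬝ᵥ F ω : ℝ) : ℂ))) | 𝓕] =ᵐ[P]
      fun ω => ((Real.exp (-(1/2) * (y ⬝ᵥ (A ω).mulVec y)) : ℝ) : ℂ)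

/-- The dimensional constant `2√6 + 3√2 + 2 + √d`. -/
def Cfac (d : ℕ) : ℝ := 2 * Real.sqrt 6 + 3 * Real.sqrt 2 + 2 + Real.sqrt d

/-- `max{ |log(2^d det K/(2‖K‖_op + λ(K))^d)| , log(2^d det K/λ(K)^d) }`. -/
def maxLog {d : ℕ} (K : Matrix (Fin d) (Fin d) ℝ) : ℝ :=
  max |Real.log ((2 ^ d * K.det) / ((2 * opNorm K + lambdaMin K) ^ d))|
      (Real.log ((2 ^ d * K.det) / (lambdaMin K ^ d)))


/-- The event `E = {‖A − K‖_op ≤ λ(K)/2}`. -/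
def EvSet {Ω : Type*} {d : ℕ} (A : Ω → Matrix (Fin d) (Fin d) ℝ)
    (K : Matrix (Fin d) (Fin d) ℝ) : Set Ω :=
  {ω | opNorm (A ω - K) ≤ lambdaMin K / 2}


/-- The interpolating matrix `Γ_t = tA + (1−t)K`. -/
def Gam {d : ℕ} (A K : Matrix (Fin d) (Fin d) ℝ) (t : ℝ) : Matrix (Fin d) (Fin d) ℝ :=
  t • A + (1 - t) • K

/-- The interpolating density ratio `g(A,t,x) = φ_{Γ_t}(x)/φ_K(x)`. -/
def gfun {d : ℕ} (A K : Matrix (Fin d) (Fin d) ℝ) (t : ℝ) (x : Fin d → ℝ) : ℝ :=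
  gaussDensity (Gam A K t) x / gaussDensity K x

/-- `h_k(A,t,x) = (∂^k g/∂t^k)(A,t,x) / g(A,t,x)`. -/
def hfun {d : ℕ} (k : ℕ) (A K : Matrix (Fin d) (Fin d) ℝ) (t : ℝ) (x : Fin d → ℝ) : ℝ :=
  iteratedDeriv k (fun s => gfun A K s x) t / gfun A K t x

/-- `g̃(A,t,x) = E[φ_{Γ_t}(x) 1_E] / (P(E) φ_K(x))`. -/
def gtilde {Ω : Type*} [MeasurableSpace Ω] (P : Measure Ω) {d : ℕ}
    (A : Ω → Matrix (Fin d) (Fin d) ℝ) (K : Matrix (Fin d) (Fin d) ℝ)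
    (t : ℝ) (x : Fin d → ℝ) : ℝ :=
  (∫ ω in EvSet A K, gaussDensity (Gam (A ω) K t) x ∂P) /
    ((P (EvSet A K)).toReal * gaussDensity K x)

end

/-! ### Part 1: linear algebra -/

lemma euclNorm_eq {d : ℕ} (x : Fin d → ℝ) : euclNorm x = ‖WithLp.toLp 2 x‖ := by
  simp [euclNorm, EuclideanSpace.norm_eq]

lemma euclNorm_nonneg {d : ℕ} (x : Fin d → ℝ) : 0 ≤ euclNorm x := Real.sqrt_nonneg _

lemma euclNorm_smul {d : ℕ} (c : ℝ) (x : Fin d → ℝ) : euclNorm (c • x) = |c| * euclNorm x := by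
  rw [euclNorm_eq, euclNorm_eq, WithLp.toLp_smul, norm_smul, Real.norm_eq_abs]

lemma euclNorm_sq {d : ℕ} (x : Fin d → ℝ) : euclNorm x ^ 2 = x ⬝ᵥ x := by
  rw [euclNorm, Real.sq_sqrt (by positivity)]
  simp [dotProduct, sq]

lemma euclNorm_pos {d : ℕ} {x : Fin d → ℝ} (hx : x ≠ 0) : 0 < euclNorm x := by
  rw [euclNorm_eq, norm_pos_iff]
  simpa using hx

lemma euclNorm_cs {d : ℕ} (x y : Fin d → ℝ) : |x ⬝ᵥ y| ≤ euclNorm x * euclNorm y := by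
  have h := abs_real_inner_le_norm (WithLp.toLp 2 y) (WithLp.toLp 2 x)
  rw [euclNorm_eq, euclNorm_eq, mul_comm]
  simpa [EuclideanSpace.inner_toLp_toLp] using h

lemma abs_coord_le {d : ℕ} (x : Fin d → ℝ) (i : Fin d) : |x i| ≤ euclNorm x := by
  rw [euclNorm, ← Real.sqrt_sq_eq_abs]
  exact Real.sqrt_le_sqrt (Finset.single_le_sum (f := fun i => x i ^ 2)
    (fun _ _ => sq_nonneg _) (Finset.mem_univ i))

lemma continuous_euclNorm {d : ℕ} : Continuous (euclNorm (d := d)) := by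
  unfold euclNorm; fun_prop

lemma isCompact_eSphere (d : ℕ) : IsCompact {x : Fin d → ℝ | euclNorm x = 1} := by
  refine (isCompact_univ_pi (fun _ : Fin d => isCompact_Icc (a := (-1 : ℝ)) (b := 1))).of_isClosed_subset
    (isClosed_eq continuous_euclNorm continuous_const) ?_
  intro x hx i _
  exact abs_le.mp ((abs_coord_le x i).trans (le_of_eq hx))

lemma eSphere_nonempty {d : ℕ} (hd : 1 ≤ d) : {x : Fin d → ℝ | euclNorm x = 1}.Nonempty := by
  refine ⟨Pi.single ⟨0, hd⟩ 1, ?_⟩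
  simp [euclNorm, Pi.single_apply]

lemma opNorm_le_iff {d : ℕ} (hd : 1 ≤ d) (M : Matrix (Fin d) (Fin d) ℝ) (r : ℝ) :
    opNorm M ≤ r ↔ ∀ y, euclNorm (M.mulVec y) ≤ r * euclNorm y := by
  have himg : {r : ℝ | ∃ x : Fin d → ℝ, euclNorm x = 1 ∧ r = euclNorm (M.mulVec x)}
      = (fun x => euclNorm (M.mulVec x)) '' {x | euclNorm x = 1} := by
    ext r; simp [eq_comm]
  have hc : Continuous (fun x => euclNorm (M.mulVec x)) :=
    continuous_euclNorm.comp (by fun_prop)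
  have hb := ((isCompact_eSphere d).image hc).bddAbove
  unfold opNorm
  rw [himg]
  constructor
  · intro h y
    by_cases hy : y = 0
    · subst hy; simp [euclNorm]
    have hp := euclNorm_pos hy
    have h1 : euclNorm ((euclNorm y)⁻¹ • y) = 1 := by
      rw [euclNorm_smul, abs_of_pos (inv_pos.mpr hp), inv_mul_cancel₀ hp.ne']
    have h2 := (le_csSup hb ⟨_, h1, rfl⟩).trans h
    simp only [mulVec_smul, euclNorm_smul, abs_of_pos (inv_pos.mpr hp)] at h2
    rw [inv_mul_le_iff₀ hp] at h2
    linarith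
  · intro h
    apply csSup_le ((eSphere_nonempty hd).image _)
    rintro _ ⟨x, hx, rfl⟩
    have := h x
    rw [hx, mul_one] at this
    exact this

lemma lambdaMin_facts {d : ℕ} (hd : 1 ≤ d) (K : Matrix (Fin d) (Fin d) ℝ) (hK : K.PosDef) :
    0 < lambdaMin K ∧ ∀ y, lambdaMin K * euclNorm y ^ 2 ≤ y ⬝ᵥ K.mulVec y := by
  have himg : {r : ℝ | ∃ x : Fin d → ℝ, euclNorm x = 1 ∧ r = x ⬝ᵥ K.mulVec x}
      = (fun x => x ⬝ᵥ K.mulVec x) '' {x | euclNorm x = 1} := by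
    ext r; simp [eq_comm]
  have hc : Continuous (fun x : Fin d → ℝ => x ⬝ᵥ K.mulVec x) := by fun_prop
  have hcomp := (isCompact_eSphere d).image hc
  have hne := (eSphere_nonempty hd).image (fun x => x ⬝ᵥ K.mulVec x)
  unfold lambdaMin
  rw [himg]
  constructor
  · obtain ⟨x, hx, hx2⟩ := hcomp.sInf_mem hne
    rw [← hx2]
    have : x ≠ 0 := by rintro rfl; simp [euclNorm] at hx
    simpa using hK.dotProduct_mulVec_pos this
  · intro y
    by_cases hy : y = 0
    · subst hy; simp [euclNorm]
    have hp := euclNorm_pos hy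
    have h1 : euclNorm ((euclNorm y)⁻¹ • y) = 1 := by
      rw [euclNorm_smul, abs_of_pos (inv_pos.mpr hp), inv_mul_cancel₀ hp.ne']
    have h2 := csInf_le hcomp.bddBelow ⟨_, h1, rfl⟩
    simp only [mulVec_smul, smul_dotProduct, dotProduct_smul, smul_eq_mul] at h2
    rw [← mul_assoc, ← sq, inv_pow, inv_mul_eq_div, le_div_iff₀ (by positivity)] at h2
    exact h2

/-- The compact parameter set. -/
def goodSet {d : ℕ} (K : Matrix (Fin d) (Fin d) ℝ) : Set (Fin d → Fin d → ℝ) :=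
  {M | (Matrix.of M).IsHermitian ∧
    ∀ y, euclNorm ((Matrix.of M - K).mulVec y) ≤ lambdaMin K / 2 * euclNorm y}

lemma isClosed_goodSet {d : ℕ} (K : Matrix (Fin d) (Fin d) ℝ) : IsClosed (goodSet K) := by
  have h1 : IsClosed {M : Fin d → Fin d → ℝ | (Matrix.of M).IsHermitian} := by
    have : {M : Fin d → Fin d → ℝ | (Matrix.of M).IsHermitian} =
        {M | ∀ i j, M j i = M i j} := by
      ext M
      simp [Matrix.IsHermitian, ← Matrix.ext_iff]
    rw [this]
    simp only [Set.ofPred_forall]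
    exact isClosed_iInter fun i => isClosed_iInter fun j =>
      isClosed_eq (by fun_prop) (by fun_prop)
  have h2 : IsClosed {M : Fin d → Fin d → ℝ | ∀ y : Fin d → ℝ,
      euclNorm ((Matrix.of M - K).mulVec y) ≤ lambdaMin K / 2 * euclNorm y} := by
    simp only [Set.ofPred_forall]
    refine isClosed_iInter fun y => isClosed_le (continuous_euclNorm.comp ?_) continuous_const
    refine continuous_pi fun i => ?_
    simp only [mulVec, dotProduct, Matrix.sub_apply, Matrix.of_apply]
    fun_prop
  exact h1.inter h2

lemma isCompact_goodSet {d : ℕ} (K : Matrix (Fin d) (Fin d) ℝ) : IsCompact (goodSet K) := by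
  refine (isCompact_univ_pi (fun i : Fin d => isCompact_univ_pi (fun j : Fin d =>
    isCompact_Icc (a := K i j - lambdaMin K / 2) (b := K i j + lambdaMin K / 2)))).of_isClosed_subset
    (isClosed_goodSet K) ?_
  intro M hM i _ j _
  have h1 := hM.2 (Pi.single j 1)
  have h2 := (abs_coord_le _ i).trans h1
  have h3 : euclNorm (Pi.single j (1:ℝ) : Fin d → ℝ) = 1 := by
    simp [euclNorm, Pi.single_apply]
  rw [h3] at h2
  simp only [mulVec_single_one, Matrix.col_apply, Matrix.sub_apply, Matrix.of_apply, mul_one] at h2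
  have := abs_le.mp h2
  exact ⟨by linarith, by linarith⟩

lemma gam_posDef {d : ℕ} (hd : 1 ≤ d) (K : Matrix (Fin d) (Fin d) ℝ) (hK : K.PosDef)
    {M : Fin d → Fin d → ℝ} (hM : M ∈ goodSet K) {t : ℝ} (ht : t ∈ Set.Icc (-1/2 : ℝ) (3/2)) :
    (Gam (Matrix.of M) K t).PosDef := by
  obtain ⟨hl, hlK⟩ := lambdaMin_facts hd K hK
  refine Matrix.PosDef.of_dotProduct_mulVec_pos ?_ ?_
  · unfold Gam
    have e1 := hM.1
    have e2 := hK.1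
    unfold Matrix.IsHermitian at *
    rw [conjTranspose_add, conjTranspose_smul, conjTranspose_smul, e1, e2]
    simp only [star_trivial]
  · intro y hy
    have hp := euclNorm_pos hy
    have e : Gam (Matrix.of M) K t = K + t • (Matrix.of M - K) := by
      unfold Gam; module
    rw [e]
    have h1 : |y ⬝ᵥ (Matrix.of M - K).mulVec y| ≤ lambdaMin K / 2 * euclNorm y ^ 2 := by
      refine (euclNorm_cs _ _).trans ?_
      nlinarith [hM.2 y]
    have h2 : |t| ≤ 3 / 2 := abs_le.mpr ⟨by linarith [ht.1], ht.2⟩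
    have h3 : |t * (y ⬝ᵥ (Matrix.of M - K).mulVec y)| ≤ 3 / 2 * (lambdaMin K / 2 * euclNorm y ^ 2) := by
      rw [abs_mul]
      exact mul_le_mul h2 h1 (abs_nonneg _) (by norm_num)
    have h4 := (abs_le.mp h3).1
    have h5 := hlK y
    simp only [star_trivial, add_mulVec, smul_mulVec, dotProduct_add, dotProduct_smul, smul_eq_mul]
    have : 0 < lambdaMin K * euclNorm y ^ 2 := by positivity
    linarith

lemma evSet_eq {Ω : Type*} {d : ℕ} (hd : 1 ≤ d) (K : Matrix (Fin d) (Fin d) ℝ)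
    (A : Ω → Matrix (Fin d) (Fin d) ℝ) (hA : ∀ ω, (A ω).PosSemidef) :
    EvSet A K = (fun ω i j => A ω i j) ⁻¹' goodSet K := by
  ext ω
  have : (Matrix.of fun i j => A ω i j) = A ω := rfl
  simp only [EvSet, Set.mem_ofPred_eq, opNorm_le_iff hd, goodSet, Set.mem_preimage, this,
    (hA ω).1, true_and]

/-! ### Part 2: a class of functions stable under differentiation in `t` -/

/-- Functions of `(M, t, x)` which are polynomial in the entries of `M`, in `t`, in the
coordinates of `x` and in `1 / det Γ_t`. -/
inductive Nice {d : ℕ} (K : Matrix (Fin d) (Fin d) ℝ) :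
    ((Fin d → Fin d → ℝ) → ℝ → (Fin d → ℝ) → ℝ) → Prop
  | const (c : ℝ) : Nice K (fun _ _ _ => c)
  | coordx (i : Fin d) : Nice K (fun _ _ x => x i)
  | entry (i j : Fin d) : Nice K (fun M _ _ => M i j)
  | time : Nice K (fun _ t _ => t)
  | invdet : Nice K (fun M t _ => (Gam (Matrix.of M) K t).det⁻¹)
  | add {f g} (hf : Nice K f) (hg : Nice K g) : Nice K (fun M t x => f M t x + g M t x)
  | mul {f g} (hf : Nice K f) (hg : Nice K g) : Nice K (fun M t x => f M t x * g M t x)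

namespace Nice

variable {d : ℕ} {K : Matrix (Fin d) (Fin d) ℝ}

lemma sum {ι : Type*} (s : Finset ι) {f : ι → (Fin d → Fin d → ℝ) → ℝ → (Fin d → ℝ) → ℝ}
    (hf : ∀ i ∈ s, Nice K (f i)) : Nice K (fun M t x => ∑ i ∈ s, f i M t x) := by
  classical
  induction s using Finset.induction_on with
  | empty => simpa using Nice.const 0
  | insert a s ha ih =>
    simp only [Finset.sum_insert ha]
    exact (hf a (by simp)).add (ih fun i hi => hf i (by simp [hi]))

lemma prod {ι : Type*} (s : Finset ι) {f : ι → (Fin d → Fin d → ℝ) → ℝ → (Fin d → ℝ) → ℝ}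
    (hf : ∀ i ∈ s, Nice K (f i)) : Nice K (fun M t x => ∏ i ∈ s, f i M t x) := by
  classical
  induction s using Finset.induction_on with
  | empty => simpa using Nice.const 1
  | insert a s ha ih =>
    simp only [Finset.prod_insert ha]
    exact (hf a (by simp)).mul (ih fun i hi => hf i (by simp [hi]))

lemma pow {f : (Fin d → Fin d → ℝ) → ℝ → (Fin d → ℝ) → ℝ} (hf : Nice K f) (n : ℕ) :
    Nice K (fun M t x => f M t x ^ n) := by
  induction n with
  | zero => simpa using Nice.const 1
  | succ n ih => simpa only [pow_succ] using ih.mul hf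

lemma det {f : Fin d → Fin d → (Fin d → Fin d → ℝ) → ℝ → (Fin d → ℝ) → ℝ}
    (hf : ∀ i j, Nice K (f i j)) :
    Nice K (fun M t x => (Matrix.of fun i j => f i j M t x).det) := by
  simp only [Matrix.det_apply', Matrix.of_apply]
  exact sum _ fun σ _ => (Nice.const _).mul (prod _ fun i _ => hf _ _)

lemma gamEntry (i j : Fin d) : Nice K (fun M t _ => (Gam (Matrix.of M) K t) i j) := by
  have : Nice K (fun M t _ => t * M i j + (1 + (-1) * t) * K i j) :=
    (Nice.time.mul (Nice.entry i j)).add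
      (((Nice.const 1).add ((Nice.const (-1)).mul Nice.time)).mul (Nice.const _))
  convert this using 4
  simp only [Gam, Matrix.add_apply, Matrix.smul_apply, Matrix.of_apply, smul_eq_mul]; ring

lemma gamDet : Nice K (fun M t _ => (Gam (Matrix.of M) K t).det) :=
  det (f := fun i j M t _ => (Gam (Matrix.of M) K t) i j) gamEntry

lemma gamAdj (i j : Fin d) : Nice K (fun M t _ => (Gam (Matrix.of M) K t).adjugate i j) := by
  simp only [Matrix.adjugate_apply]
  refine det (f := fun a b M t _ => ((Gam (Matrix.of M) K t).updateRow j (Pi.single i 1)) a b) ?_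
  intro a b
  by_cases h : a = j
  · subst h
    simp only [Matrix.updateRow_self]
    exact Nice.const _
  · simp only [Matrix.updateRow_ne h]
    exact gamEntry a b

/-- The quadratic form `⟨x, Γ_t⁻¹ x⟩`. -/
lemma quad : Nice K (fun M t x => x ⬝ᵥ (Gam (Matrix.of M) K t)⁻¹.mulVec x) := by
  have : Nice K (fun M t x => ∑ i, x i * ∑ j, ((Gam (Matrix.of M) K t).det⁻¹ *
      (Gam (Matrix.of M) K t).adjugate i j) * x j) :=
    sum _ fun i _ => (Nice.coordx i).mul (sum _ fun j _ =>
      ((Nice.invdet).mul (gamAdj i j)).mul (Nice.coordx j))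
  convert this using 4
  simp only [dotProduct, mulVec, Matrix.inv_def, Ring.inverse_eq_inv', Matrix.smul_apply,
    smul_eq_mul]

lemma gamDet_hasDeriv : ∃ f', Nice K f' ∧ ∀ M t x,
    HasDerivAt (fun s => (Gam (Matrix.of M) K s).det) (f' M t x) t := by
  refine ⟨fun M t x => ∑ σ : Equiv.Perm (Fin d), ((Equiv.Perm.sign σ : ℤ) : ℝ) *
    ∑ i, (∏ j ∈ Finset.univ.erase i, Gam (Matrix.of M) K t (σ j) j) *
      (M (σ i) i + (-1) * K (σ i) i), ?_, ?_⟩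
  · exact sum _ fun σ _ => (Nice.const _).mul (sum _ fun i _ =>
      (prod _ fun j _ => gamEntry _ _).mul ((Nice.entry _ _).add (Nice.const _)))
  · intro M t x
    simp only [Matrix.det_apply']
    refine HasDerivAt.fun_sum fun σ _ => HasDerivAt.const_mul _ ?_
    have := HasDerivAt.fun_finsetProd (u := Finset.univ) (x := t)
      (f := fun i s => Gam (Matrix.of M) K s (σ i) i)
      (f' := fun i => M (σ i) i + (-1) * K (σ i) i) (fun i _ => by
        have h : (fun s => Gam (Matrix.of M) K s (σ i) i) =
            fun s => s * M (σ i) i + (1 - s) * K (σ i) i := by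
          funext s; simp [Gam]
        rw [h]
        have h1 := (hasDerivAt_id t).mul_const (M (σ i) i)
        have h2 := ((hasDerivAt_id t).const_sub 1).mul_const (K (σ i) i)
        refine (h1.add h2).congr_deriv ?_
        ring)
    simpa only [smul_eq_mul] using this

lemma hasDeriv {f : (Fin d → Fin d → ℝ) → ℝ → (Fin d → ℝ) → ℝ} (hf : Nice K f) :
    ∃ f', Nice K f' ∧ ∀ M t x, (Gam (Matrix.of M) K t).det ≠ 0 →
      HasDerivAt (fun s => f M s x) (f' M t x) t := by
  induction hf with
  | const c => exact ⟨_, Nice.const 0, fun M t x _ => hasDerivAt_const _ _⟩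
  | coordx i => exact ⟨_, Nice.const 0, fun M t x _ => hasDerivAt_const _ _⟩
  | entry i j => exact ⟨_, Nice.const 0, fun M t x _ => hasDerivAt_const _ _⟩
  | time => exact ⟨_, Nice.const 1, fun M t x _ => hasDerivAt_id _⟩
  | invdet =>
    obtain ⟨f', h1, h2⟩ := gamDet_hasDeriv (K := K)
    refine ⟨_, (Nice.const (-1)).mul (h1.mul (Nice.invdet.pow 2)), fun M t x h => ?_⟩
    refine ((h2 M t x).fun_inv h).congr_deriv ?_
    rw [inv_pow, div_eq_mul_inv]; ring
  | add hf hg ihf ihg =>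
    obtain ⟨f', h1, h2⟩ := ihf
    obtain ⟨g', h3, h4⟩ := ihg
    exact ⟨_, h1.add h3, fun M t x h => (h2 M t x h).add (h4 M t x h)⟩
  | mul hf hg ihf ihg =>
    obtain ⟨f', h1, h2⟩ := ihf
    obtain ⟨g', h3, h4⟩ := ihg
    exact ⟨_, (h1.mul hg).add (hf.mul h3), fun M t x h => (h2 M t x h).mul (h4 M t x h)⟩

lemma measurable {f : (Fin d → Fin d → ℝ) → ℝ → (Fin d → ℝ) → ℝ} (hf : Nice K f) :
    Measurable (fun p : (Fin d → Fin d → ℝ) × ℝ × (Fin d → ℝ) => f p.1 p.2.1 p.2.2) := by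
  induction hf with
  | const c => fun_prop
  | coordx i => fun_prop
  | entry i j => fun_prop
  | time => fun_prop
  | invdet =>
    refine Measurable.inv ?_
    simp only [Matrix.det_apply', Gam, Matrix.add_apply, Matrix.smul_apply, Matrix.of_apply]
    fun_prop
  | add hf hg ihf ihg => exact ihf.add ihg
  | mul hf hg ihf ihg => exact ihf.mul ihg

lemma continuousOn {f : (Fin d → Fin d → ℝ) → ℝ → (Fin d → ℝ) → ℝ} (hf : Nice K f) :
    ContinuousOn (fun p : (Fin d → Fin d → ℝ) × ℝ × (Fin d → ℝ) => f p.1 p.2.1 p.2.2)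
      {p | (Gam (Matrix.of p.1) K p.2.1).det ≠ 0} := by
  induction hf with
  | const c => fun_prop
  | coordx i => fun_prop
  | entry i j => fun_prop
  | time => fun_prop
  | invdet =>
    refine ContinuousOn.inv₀ ?_ (fun p hp => hp)
    simp only [Matrix.det_apply', Gam, Matrix.add_apply, Matrix.smul_apply, Matrix.of_apply]
    fun_prop
  | add hf hg ihf ihg => exact ihf.add ihg
  | mul hf hg ihf ihg => exact ihf.mul ihg

/-- Polynomial growth in `x`, uniformly over the compact set of parameters. -/
lemma bound (hd : 1 ≤ d) (hK : K.PosDef)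
    {f : (Fin d → Fin d → ℝ) → ℝ → (Fin d → ℝ) → ℝ} (hf : Nice K f) :
    ∃ (C : ℝ) (m : ℕ), 0 ≤ C ∧ ∀ M ∈ goodSet K, ∀ t ∈ Set.Icc (-1/2 : ℝ) (3/2), ∀ x,
      |f M t x| ≤ C * (1 + ‖x‖) ^ m := by
  induction hf with
  | const c => exact ⟨|c|, 0, abs_nonneg _, by simp⟩
  | coordx i =>
    refine ⟨1, 1, zero_le_one, fun M _ t _ x => ?_⟩
    have := norm_le_pi_norm x i
    rw [Real.norm_eq_abs] at this
    linarith
  | entry i j =>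
    obtain ⟨C, hC⟩ := (isCompact_goodSet K).exists_bound_of_continuousOn
      (f := fun M => M i j) (by fun_prop)
    refine ⟨max C 0, 0, le_max_right _ _, fun M hM t _ x => ?_⟩
    simpa using Or.inl (hC M hM)
  | time =>
    refine ⟨3/2, 0, by norm_num, fun M _ t ht x => ?_⟩
    simp only [pow_zero, mul_one]
    exact abs_le.mpr ⟨by linarith [ht.1], ht.2⟩
  | invdet =>
    obtain ⟨C, hC⟩ := ((isCompact_goodSet K).prod
      (isCompact_Icc (a := (-1/2 : ℝ)) (b := 3/2))).exists_bound_of_continuousOn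
      (f := fun p => (Gam (Matrix.of p.1) K p.2).det⁻¹) (by
        refine ContinuousOn.inv₀ ?_ (fun p hp => (gam_posDef hd K hK hp.1 hp.2).det_pos.ne')
        simp only [Matrix.det_apply', Gam, Matrix.add_apply, Matrix.smul_apply, Matrix.of_apply]
        fun_prop)
    refine ⟨max C 0, 0, le_max_right _ _, fun M hM t ht x => ?_⟩
    simpa using Or.inl (hC (M, t) ⟨hM, ht⟩)
  | add hf hg ihf ihg =>
    obtain ⟨C1, m1, p1, h1⟩ := ihf
    obtain ⟨C2, m2, p2, h2⟩ := ihg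
    refine ⟨C1 + C2, max m1 m2, by positivity, fun M hM t ht x => ?_⟩
    have hx : 1 ≤ 1 + ‖x‖ := by linarith [norm_nonneg x]
    have e1 := mul_le_mul_of_nonneg_left (pow_le_pow_right₀ hx (le_max_left m1 m2)) p1
    have e2 := mul_le_mul_of_nonneg_left (pow_le_pow_right₀ hx (le_max_right m1 m2)) p2
    refine (abs_add_le _ _).trans ?_
    rw [add_mul]
    exact add_le_add ((h1 M hM t ht x).trans e1) ((h2 M hM t ht x).trans e2)
  | mul hf hg ihf ihg =>
    obtain ⟨C1, m1, p1, h1⟩ := ihf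
    obtain ⟨C2, m2, p2, h2⟩ := ihg
    refine ⟨C1 * C2, m1 + m2, by positivity, fun M hM t ht x => ?_⟩
    rw [abs_mul, pow_add, mul_mul_mul_comm]
    exact mul_le_mul (h1 M hM t ht x) (h2 M hM t ht x) (abs_nonneg _) (by positivity)

end Nice

/-! ### Part 3: the Gaussian density along the interpolation -/

section density

variable {d : ℕ} {K : Matrix (Fin d) (Fin d) ℝ}

lemma gaussDensity_pos {M : Matrix (Fin d) (Fin d) ℝ} (hM : 0 < M.det) (x : Fin d → ℝ) :
    0 < gaussDensity M x := by
  unfold gaussDensity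
  have := Real.pi_pos
  positivity

lemma density_hasDeriv : ∃ L, Nice K L ∧ ∀ M t x, 0 < (Gam (Matrix.of M) K t).det →
    HasDerivAt (fun s => gaussDensity (Gam (Matrix.of M) K s) x)
      (L M t x * gaussDensity (Gam (Matrix.of M) K t) x) t := by
  obtain ⟨D', hD, hD'⟩ := Nice.gamDet_hasDeriv (K := K)
  obtain ⟨Q', hQ, hQ'⟩ := (Nice.quad (K := K)).hasDeriv
  refine ⟨_, ((Nice.const (-(1/2))).mul (hD.mul Nice.invdet)).add
    ((Nice.const (-(1/2))).mul hQ), fun M t x hpos => ?_⟩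
  have hpi := Real.pi_pos
  have hc : 0 < (2 * Real.pi) ^ d * (Gam (Matrix.of M) K t).det := by positivity
  have h1 := (((hD' M t x).const_mul ((2 * Real.pi) ^ d)).sqrt hc.ne').fun_inv
    (Real.sqrt_pos.mpr hc).ne'
  have h2 := ((hQ' M t x hpos.ne').const_mul (-(1/2))).exp
  have h3 := h1.mul h2
  refine h3.congr_deriv ?_
  unfold gaussDensity
  rw [Real.sq_sqrt hc.le]
  have hs := (Real.sqrt_pos.mpr hc).ne'
  have hp : (2 * Real.pi) ^ d ≠ 0 := by positivity
  generalize Real.sqrt ((2 * Real.pi) ^ d * (Gam (Matrix.of M) K t).det) = S at *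
  generalize (2 * Real.pi) ^ d = c at *
  have hne := hpos.ne'
  field_simp

end density

section domination

variable {d : ℕ} {K : Matrix (Fin d) (Fin d) ℝ}

lemma quad_lower (hd : 1 ≤ d) (hK : K.PosDef) : ∃ c : ℝ, 0 < c ∧
    ∀ M ∈ goodSet K, ∀ t ∈ Set.Icc (-1/2 : ℝ) (3/2), ∀ x : Fin d → ℝ,
      c * ‖x‖ ^ 2 ≤ x ⬝ᵥ (Gam (Matrix.of M) K t)⁻¹.mulVec x := by
  have hpos : ∀ M ∈ goodSet K, ∀ t ∈ Set.Icc (-1/2 : ℝ) (3/2), ∀ x : Fin d → ℝ, x ≠ 0 →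
      0 < x ⬝ᵥ (Gam (Matrix.of M) K t)⁻¹.mulVec x := by
    intro M hM t ht x hx
    simpa using (gam_posDef hd K hK hM ht).inv.dotProduct_mulVec_pos hx
  obtain ⟨C, hC⟩ := ((isCompact_goodSet K).prod
      ((isCompact_Icc (a := (-1/2 : ℝ)) (b := 3/2)).prod
        (isCompact_sphere (0 : Fin d → ℝ) 1))).exists_bound_of_continuousOn
      (f := fun p => (p.2.2 ⬝ᵥ (Gam (Matrix.of p.1) K p.2.1)⁻¹.mulVec p.2.2)⁻¹) (by
        refine ContinuousOn.inv₀ ?_ ?_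
        · exact (Nice.quad (K := K)).continuousOn.mono
            fun p hp => (gam_posDef hd K hK hp.1 hp.2.1).det_pos.ne'
        · intro p hp
          have hx : p.2.2 ≠ 0 := by
            intro h
            have := hp.2.2
            simp [h] at this
          exact (hpos _ hp.1 _ hp.2.1 _ hx).ne')
  refine ⟨(max C 1)⁻¹, by positivity, fun M hM t ht x => ?_⟩
  by_cases hx : x = 0
  · simp [hx]
  have hn : 0 < ‖x‖ := norm_pos_iff.mpr hx
  have h1 : (‖x‖⁻¹ • x) ∈ Metric.sphere (0 : Fin d → ℝ) 1 := by
    simp [norm_smul, inv_mul_cancel₀ hn.ne']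
  have h2 := hC (M, t, ‖x‖⁻¹ • x) ⟨hM, ht, h1⟩
  have h3 := hpos M hM t ht x hx
  simp only [mulVec_smul, smul_dotProduct, dotProduct_smul, smul_eq_mul] at h2
  set q := x ⬝ᵥ (Gam (Matrix.of M) K t)⁻¹.mulVec x with hq
  rw [Real.norm_eq_abs, abs_of_pos (by positivity)] at h2
  have h4 : ‖x‖ ^ 2 / q ≤ max C 1 := by
    refine le_trans (le_of_eq ?_) (h2.trans (le_max_left _ _))
    field_simp
  rw [inv_mul_le_iff₀ (by positivity)]
  rw [div_le_iff₀ h3] at h4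
  exact h4

lemma density_bound (hd : 1 ≤ d) (hK : K.PosDef) : ∃ C c : ℝ, 0 ≤ C ∧ 0 < c ∧
    ∀ M ∈ goodSet K, ∀ t ∈ Set.Icc (-1/2 : ℝ) (3/2), ∀ x : Fin d → ℝ,
      gaussDensity (Gam (Matrix.of M) K t) x ≤ C * Real.exp (-(c * ‖x‖ ^ 2)) := by
  obtain ⟨c, hc, hcq⟩ := quad_lower hd hK
  obtain ⟨C, hC⟩ := ((isCompact_goodSet K).prod
      (isCompact_Icc (a := (-1/2 : ℝ)) (b := 3/2))).exists_bound_of_continuousOn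
      (f := fun p => (Real.sqrt ((2 * Real.pi) ^ d * (Gam (Matrix.of p.1) K p.2).det))⁻¹) (by
        refine ContinuousOn.inv₀ ?_ (fun p hp => ?_)
        · simp only [Matrix.det_apply', Gam, Matrix.add_apply, Matrix.smul_apply, Matrix.of_apply]
          fun_prop
        · have := (gam_posDef hd K hK hp.1 hp.2).det_pos
          have := Real.pi_pos
          positivity)
  refine ⟨max C 0, c / 2, le_max_right _ _, by positivity, fun M hM t ht x => ?_⟩
  unfold gaussDensity
  have h1 := (le_abs_self _).trans ((hC (M, t) ⟨hM, ht⟩).trans (le_max_left C 0))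
  refine mul_le_mul h1 (Real.exp_le_exp.mpr ?_) (Real.exp_pos _).le (le_max_right _ _)
  have := hcq M hM t ht x
  linarith

lemma poly_exp_bound (m N : ℕ) {c : ℝ} (hc : 0 < c) : ∃ B : ℝ, 0 ≤ B ∧ ∀ r : ℝ, 0 ≤ r →
    (1 + r) ^ m * Real.exp (-(c * r ^ 2)) ≤ B * (1 + r) ^ (-(N : ℝ)) := by
  refine ⟨(m + N).factorial / c ^ (m + N) * Real.exp (2 * c), by positivity, fun r hr => ?_⟩
  have h1 : 0 < 1 + r := by linarith
  have h2 := Real.pow_div_factorial_le_exp (x := c * (1 + r)) (by positivity) (m + N)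
  rw [div_le_iff₀ (by positivity), mul_pow] at h2
  have h3 : Real.exp (-(c * r ^ 2)) ≤ Real.exp (2 * c) * Real.exp (-(c * (1 + r))) := by
    rw [← Real.exp_add]
    apply Real.exp_le_exp.mpr
    nlinarith [sq_nonneg (r - 1/2), mul_nonneg hc.le (sq_nonneg (r - 1/2))]
  rw [Real.rpow_neg h1.le, Real.rpow_natCast, ← div_eq_mul_inv, le_div_iff₀ (by positivity)]
  have h4 : (1 + r) ^ (m + N) * Real.exp (-(c * (1 + r))) ≤ (m + N).factorial / c ^ (m + N) := by
    rw [Real.exp_neg, ← div_eq_mul_inv, div_le_div_iff₀ (Real.exp_pos _) (by positivity)]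
    linarith
  calc (1 + r) ^ m * Real.exp (-(c * r ^ 2)) * (1 + r) ^ N
      = (1 + r) ^ (m + N) * Real.exp (-(c * r ^ 2)) := by ring
    _ ≤ (1 + r) ^ (m + N) * (Real.exp (2 * c) * Real.exp (-(c * (1 + r)))) := by gcongr
    _ = ((1 + r) ^ (m + N) * Real.exp (-(c * (1 + r)))) * Real.exp (2 * c) := by ring
    _ ≤ _ := by gcongr

lemma Nice.dominated (hd : 1 ≤ d) (hK : K.PosDef)
    {f : (Fin d → Fin d → ℝ) → ℝ → (Fin d → ℝ) → ℝ} (hf : Nice K f) :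
    ∃ B : (Fin d → ℝ) → ℝ, Integrable B volume ∧ Measurable B ∧
      ∀ M ∈ goodSet K, ∀ t ∈ Set.Icc (-1/2 : ℝ) (3/2), ∀ x,
      |f M t x * gaussDensity (Gam (Matrix.of M) K t) x| ≤ B x := by
  obtain ⟨C1, m, hC1, h1⟩ := hf.bound hd hK
  obtain ⟨C2, c, hC2, hc, h2⟩ := density_bound hd hK
  obtain ⟨B, hB, h3⟩ := poly_exp_bound m (d + 1) hc
  refine ⟨fun x => C1 * C2 * B * (1 + ‖x‖) ^ (-((d + 1 : ℕ) : ℝ)), ?_, by fun_prop, ?_⟩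
  · refine Integrable.const_mul (integrable_one_add_norm ?_) _
    simp
  · intro M hM t ht x
    have hp := gaussDensity_pos (gam_posDef hd K hK hM ht).det_pos x
    rw [abs_mul, abs_of_pos hp]
    calc _ ≤ (C1 * (1 + ‖x‖) ^ m) * (C2 * Real.exp (-(c * ‖x‖ ^ 2))) :=
          mul_le_mul (h1 M hM t ht x) (h2 M hM t ht x) hp.le (by positivity)
      _ = C1 * C2 * ((1 + ‖x‖) ^ m * Real.exp (-(c * ‖x‖ ^ 2))) := by ring
      _ ≤ C1 * C2 * (B * (1 + ‖x‖) ^ (-((d + 1 : ℕ) : ℝ))) :=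
          mul_le_mul_of_nonneg_left (h3 _ (norm_nonneg _)) (by positivity)
      _ = _ := by ring

lemma measurable_density : Measurable (fun p : (Fin d → Fin d → ℝ) × ℝ × (Fin d → ℝ) =>
    gaussDensity (Gam (Matrix.of p.1) K p.2.1) p.2.2) := by
  unfold gaussDensity
  have h1 := (Nice.gamDet (K := K)).measurable
  have h2 := (Nice.quad (K := K)).measurable
  exact ((h1.const_mul _).sqrt.inv).mul (h2.const_mul _).exp

/-- Differentiation under the expectation. -/
lemma integral_iteratedDeriv (hd : 1 ≤ d) (hK : K.PosDef) {Ω : Type*} [MeasurableSpace Ω]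
    (Q : Measure Ω) [IsFiniteMeasure Q] (A : Ω → Fin d → Fin d → ℝ) (hAm : Measurable A)
    (hAQ : ∀ᵐ ω ∂Q, A ω ∈ goodSet K) (n : ℕ) :
    ∃ p, Nice K p ∧
    (∀ M t x, 0 < (Gam (Matrix.of M) K t).det →
      iteratedDeriv n (fun s => gaussDensity (Gam (Matrix.of M) K s) x) t
      = p M t x * gaussDensity (Gam (Matrix.of M) K t) x) ∧
    ∀ x, ∀ t ∈ Set.Ioo (-1/2 : ℝ) (3/2),
      iteratedDeriv n (fun s => ∫ ω, gaussDensity (Gam (Matrix.of (A ω)) K s) x ∂Q) t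
      = ∫ ω, p (A ω) t x * gaussDensity (Gam (Matrix.of (A ω)) K t) x ∂Q := by
  induction n with
  | zero => exact ⟨_, Nice.const 1, fun M t x _ => by simp, fun x t _ => by simp⟩
  | succ n ih =>
    obtain ⟨p, hp, h, hI⟩ := ih
    obtain ⟨p', hp', h'⟩ := hp.hasDeriv
    obtain ⟨L, hL, hL'⟩ := density_hasDeriv (K := K)
    have hq := hp'.add (hp.mul hL)
    have hderiv : ∀ M t x, 0 < (Gam (Matrix.of M) K t).det →
        HasDerivAt (fun s => p M s x * gaussDensity (Gam (Matrix.of M) K s) x)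
        ((p' M t x + p M t x * L M t x) * gaussDensity (Gam (Matrix.of M) K t) x) t := by
      intro M t x hpos
      refine ((h' M t x hpos.ne').fun_mul (hL' M t x hpos)).congr_deriv ?_
      ring
    refine ⟨_, hq, fun M t x hpos => ?_, fun x t ht => ?_⟩
    · obtain ⟨D', hD, hD'⟩ := Nice.gamDet_hasDeriv (K := K)
      have hev : ∀ᶠ s in nhds t, 0 < (Gam (Matrix.of M) K s).det :=
        (hD' M t x).continuousAt.eventually (lt_mem_nhds hpos)
      rw [iteratedDeriv_succ]
      have hcongr : iteratedDeriv n (fun s => gaussDensity (Gam (Matrix.of M) K s) x)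
          =ᶠ[nhds t] fun s => p M s x * gaussDensity (Gam (Matrix.of M) K s) x := by
        filter_upwards [hev] with s hs using h M s x hs
      rw [hcongr.deriv_eq]
      exact (hderiv M t x hpos).deriv
    · have hnhds : Set.Ioo (-1/2 : ℝ) (3/2) ∈ nhds t := isOpen_Ioo.mem_nhds ht
      rw [iteratedDeriv_succ]
      have hcongr : iteratedDeriv n
          (fun s => ∫ ω, gaussDensity (Gam (Matrix.of (A ω)) K s) x ∂Q) =ᶠ[nhds t]
          fun s => ∫ ω, p (A ω) s x * gaussDensity (Gam (Matrix.of (A ω)) K s) x ∂Q := by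
        filter_upwards [hnhds] with s hs using hI x s hs
      rw [hcongr.deriv_eq]
      obtain ⟨B1, -, -, hB1⟩ := hp.dominated hd hK
      obtain ⟨B2, -, -, hB2⟩ := hq.dominated hd hK
      have hmeas : ∀ {f : (Fin d → Fin d → ℝ) → ℝ → (Fin d → ℝ) → ℝ}, Nice K f → ∀ s,
          AEStronglyMeasurable (fun ω =>
            f (A ω) s x * gaussDensity (Gam (Matrix.of (A ω)) K s) x) Q := by
        intro f hf s
        have e : Measurable (fun ω => (A ω, s, x)) := by fun_prop
        exact ((hf.measurable.mul measurable_density).comp e).aestronglyMeasurable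
      refine (hasDerivAt_integral_of_dominated_loc_of_deriv_le (bound := fun _ => B2 x)
        (F' := fun s ω => (p' (A ω) s x + p (A ω) s x * L (A ω) s x) *
          gaussDensity (Gam (Matrix.of (A ω)) K s) x) hnhds
        (Filter.Eventually.of_forall fun s => hmeas hp s) ?_ (hmeas hq t) ?_
        (integrable_const _) ?_).2.deriv
      · refine Integrable.mono' (integrable_const (B1 x)) (hmeas hp t) ?_
        filter_upwards [hAQ] with ω hω using hB1 _ hω t (Set.Ioo_subset_Icc_self ht) x
      · filter_upwards [hAQ] with ω hω s hs using hB2 _ hω s (Set.Ioo_subset_Icc_self hs) x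
      · filter_upwards [hAQ] with ω hω s hs
        exact hderiv _ _ _ (gam_posDef hd K hK hω (Set.Ioo_subset_Icc_self hs)).det_pos

end domination

/-! ### Part 4: Jensen, Cauchy–Schwarz and independence -/

lemma even_pow_tangent {n : ℕ} (hn : Even n) (a p : ℝ) :
    a ^ n + n * a ^ (n - 1) * (p - a) ≤ p ^ n := by
  have hc := hn.convexOn_pow (𝕜 := ℝ)
  have hd := hasDerivAt_pow n a
  rcases lt_trichotomy a p with h | h | h
  · have := hc.le_slope_of_hasDerivAt (Set.mem_univ _) (Set.mem_univ _) h hd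
    rw [slope_def_field, le_div_iff₀ (by linarith)] at this
    linarith
  · subst h; simp
  · have := hc.slope_le_of_hasDerivAt (Set.mem_univ _) (Set.mem_univ _) h hd
    rw [slope_def_field, div_le_iff₀ (by linarith)] at this
    linarith

lemma jensen_pow {Ω : Type*} [MeasurableSpace Ω] (Q : Measure Ω) {w p : Ω → ℝ} {n : ℕ}
    (hn : Even n) (hw0 : ∀ᵐ ω ∂Q, 0 ≤ w ω) (hw : Integrable w Q)
    (hpw : Integrable (fun ω => p ω * w ω) Q) (hpn : Integrable (fun ω => p ω ^ n * w ω) Q)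
    (hW : 0 < ∫ ω, w ω ∂Q) :
    (((∫ ω, p ω * w ω ∂Q) / ∫ ω, w ω ∂Q) ^ n) * (∫ ω, w ω ∂Q) ≤ ∫ ω, p ω ^ n * w ω ∂Q := by
  set W := ∫ ω, w ω ∂Q
  set I := ∫ ω, p ω * w ω ∂Q
  set a := I / W
  have h1 : ∫ ω, (a ^ n - n * a ^ (n - 1) * a) * w ω + n * a ^ (n - 1) * (p ω * w ω) ∂Q
      ≤ ∫ ω, p ω ^ n * w ω ∂Q := by
    refine integral_mono_ae ((hw.const_mul _).add (hpw.const_mul _)) hpn ?_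
    filter_upwards [hw0] with ω hω
    have := mul_le_mul_of_nonneg_right (even_pow_tangent hn a (p ω)) hω
    linarith
  rw [integral_add (hw.const_mul _) (hpw.const_mul _), integral_const_mul, integral_const_mul] at h1
  have h2 : I = a * W := by simp only [a]; field_simp
  change (a ^ n - n * a ^ (n - 1) * a) * W + n * a ^ (n - 1) * I ≤ _ at h1
  rw [h2] at h1
  linarith

lemma measurable_gaussDensity {d : ℕ} (K : Matrix (Fin d) (Fin d) ℝ) :
    Measurable (gaussDensity K) := by
  unfold gaussDensity
  simp only [dotProduct, mulVec]
  fun_prop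

lemma aemeasurable_of_law {d : ℕ} {K : Matrix (Fin d) (Fin d) ℝ} (hK : K.PosDef)
    {Ω : Type*} [MeasurableSpace Ω] {P : Measure Ω} {G : Ω → Fin d → ℝ}
    (hG : Measure.map G P = gaussLaw K) : AEMeasurable G P := by
  by_contra h
  rw [Measure.map_of_not_aemeasurable h] at hG
  have h1 := hG.symm
  unfold gaussLaw at h1
  rw [withDensity_eq_zero_iff (measurable_gaussDensity K).ennreal_ofReal.aemeasurable] at h1
  have h2 : ∀ᵐ x : Fin d → ℝ, False := by
    filter_upwards [h1] with x hx
    have := gaussDensity_pos hK.det_pos x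
    simp only [Pi.zero_apply, ENNReal.ofReal_eq_zero] at hx
    linarith
  simp only [Filter.eventually_false_iff_eq_bot, ae_eq_bot] at h2
  exact NeZero.ne (volume : Measure (Fin d → ℝ)) h2

lemma independence_key {d : ℕ} (hd : 1 ≤ d) {Ω : Type*} [MeasurableSpace Ω] (P : Measure Ω)
    [IsProbabilityMeasure P] {K : Matrix (Fin d) (Fin d) ℝ} (hK : K.PosDef)
    (A : Ω → Fin d → Fin d → ℝ) (hAm : Measurable A)
    (G : Ω → Fin d → ℝ) (hG : Measure.map G P = gaussLaw K) (hInd : IndepFun G A P)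
    {η : ℝ} (hη : η ∈ Set.Icc (-1/2 : ℝ) (3/2))
    {f : (Fin d → Fin d → ℝ) → ℝ → (Fin d → ℝ) → ℝ} (hf : Nice K f) :
    Integrable (fun ω' => ∫ ω in A ⁻¹' goodSet K,
      f (A ω) η (G ω') * (gaussDensity (Gam (Matrix.of (A ω)) K η) (G ω') /
        gaussDensity K (G ω')) ∂P) P ∧
    ∫ ω', (∫ ω in A ⁻¹' goodSet K,
      f (A ω) η (G ω') * (gaussDensity (Gam (Matrix.of (A ω)) K η) (G ω') /
        gaussDensity K (G ω')) ∂P) ∂P =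
    ∫ ω in A ⁻¹' goodSet K,
      f (A ω) η (G ω) * (gaussDensity (Gam (Matrix.of (A ω)) K η) (G ω) /
        gaussDensity K (G ω)) ∂P := by
  have hGm := aemeasurable_of_law hK hG
  have hS : MeasurableSet (goodSet K) := (isClosed_goodSet K).measurableSet
  have hE : MeasurableSet (A ⁻¹' goodSet K) := hAm hS
  obtain ⟨B, hB, hBm, hBb⟩ := hf.dominated hd hK
  have hφm := measurable_gaussDensity K
  have hφp : ∀ x, 0 < gaussDensity K x := gaussDensity_pos hK.det_pos
  let Ψ : (Fin d → ℝ) × (Fin d → Fin d → ℝ) → ℝ :=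
    (Prod.snd ⁻¹' goodSet K).indicator fun z =>
      f z.2 η z.1 * (gaussDensity (Gam (Matrix.of z.2) K η) z.1 / gaussDensity K z.1)
  have hΨm : Measurable Ψ := by
    refine Measurable.indicator ?_ (measurable_snd hS)
    have e : Measurable (fun z : (Fin d → ℝ) × (Fin d → Fin d → ℝ) => (z.2, η, z.1)) := by
      fun_prop
    exact (hf.measurable.comp e).mul ((measurable_density.comp e).div (hφm.comp measurable_fst))
  have hlaw := hInd.map_prod_eq_prod_map_map hGm hAm.aemeasurable
  have : IsFiniteMeasure (P.map G) := by infer_instance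
  have : IsFiniteMeasure (P.map A) := by infer_instance
  have hB' : Integrable (fun x => B x / gaussDensity K x) (P.map G) := by
    rw [hG]
    unfold gaussLaw
    rw [integrable_withDensity_iff_integrable_smul' hφm.ennreal_ofReal (by simp)]
    refine hB.congr (Filter.Eventually.of_forall fun x => ?_)
    have := hφp x
    simp only [ENNReal.toReal_ofReal this.le, smul_eq_mul]
    field_simp
  have hΨi : Integrable Ψ ((P.map G).prod (P.map A)) := by
    refine Integrable.mono' (hB'.comp_fst (P.map A)) hΨm.aestronglyMeasurable
      (Filter.Eventually.of_forall fun z => ?_)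
    by_cases hz : z.2 ∈ goodSet K
    · have h1 := hBb z.2 hz η hη z.1
      have h2 := hφp z.1
      have : Ψ z = f z.2 η z.1 * gaussDensity (Gam (Matrix.of z.2) K η) z.1 /
          gaussDensity K z.1 := by
        simp only [Ψ]
        rw [Set.indicator_of_mem (by exact hz), mul_div_assoc]
      rw [this, Real.norm_eq_abs, abs_div, abs_of_pos h2]
      gcongr
    · have : Ψ z = 0 := Set.indicator_of_notMem (by exact hz) _
      rw [this, norm_zero]
      have hK0 := hφp z.1
      have : 0 ≤ B z.1 := (abs_nonneg _).trans
        (hBb (fun i j => K i j) ⟨hK.1, fun y => by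
          have : (Matrix.of fun i j => K i j) - K = 0 := sub_self K
          rw [this]
          have hl := (lambdaMin_facts hd K hK).1
          have := euclNorm_nonneg y
          have e0 : euclNorm ((0 : Matrix (Fin d) (Fin d) ℝ).mulVec y) = 0 := by
            simp [euclNorm]
          rw [e0]; positivity⟩ η hη z.1)
      positivity
  have hinner : ∀ x, ∫ M, Ψ (x, M) ∂(P.map A) = ∫ ω in A ⁻¹' goodSet K,
      f (A ω) η x * (gaussDensity (Gam (Matrix.of (A ω)) K η) x / gaussDensity K x) ∂P := by
    intro x
    have hm : Measurable (fun M => Ψ (x, M)) := hΨm.comp measurable_prodMk_left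
    rw [integral_map hAm.aemeasurable hm.aestronglyMeasurable, ← integral_indicator hE]
    rfl
  have hF := hΨi.integral_prod_left
  simp only [hinner] at hF
  have hGA : AEMeasurable (fun ω => (G ω, A ω)) P := hGm.prodMk hAm.aemeasurable
  constructor
  · exact hF.comp_aemeasurable hGm
  · have h1 := integral_prod _ hΨi
    simp only [hinner] at h1
    rw [← hlaw, integral_map hGA hΨm.aestronglyMeasurable,
      integral_map hGm hF.aestronglyMeasurable] at h1
    rw [← h1, ← integral_indicator hE]
    rfl

lemma cs_sqrt {Ω : Type*} [MeasurableSpace Ω] (P : Measure Ω) {U V : Ω → ℝ}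
    (hU0 : ∀ ω, 0 ≤ U ω) (hV0 : ∀ ω, 0 ≤ V ω) (hU : Integrable U P) (hV : Integrable V P) :
    Integrable (fun ω => Real.sqrt (U ω) * Real.sqrt (V ω)) P ∧
    ∫ ω, Real.sqrt (U ω) * Real.sqrt (V ω) ∂P ≤
      Real.sqrt (∫ ω, U ω ∂P) * Real.sqrt (∫ ω, V ω ∂P) := by
  have hL : ∀ {U : Ω → ℝ}, (∀ ω, 0 ≤ U ω) → Integrable U P →
      MemLp (fun ω => Real.sqrt (U ω)) 2 P := by
    intro U h0 h
    rw [memLp_two_iff_integrable_sq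
      (Real.continuous_sqrt.comp_aestronglyMeasurable h.aestronglyMeasurable)]
    simpa only [Real.sq_sqrt (h0 _)] using h
  have h1 := hL hU0 hU
  have h2 := hL hV0 hV
  refine ⟨h1.integrable_mul h2, ?_⟩
  have h3 := integral_mul_le_Lp_mul_Lq_of_nonneg (μ := P) Real.HolderConjugate.two_two
    (f := fun ω => Real.sqrt (U ω)) (g := fun ω => Real.sqrt (V ω))
    (Filter.Eventually.of_forall fun _ => Real.sqrt_nonneg _)
    (Filter.Eventually.of_forall fun _ => Real.sqrt_nonneg _) (by simpa using h1) (by simpa using h2)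
  simp only [Real.rpow_two, Real.sq_sqrt (hU0 _), Real.sq_sqrt (hV0 _),
    ← Real.sqrt_eq_rpow] at h3
  exact h3

/-- Lemma `stime_per_th_fin`, general bound `gen_for_prod`. -/
theorem statement_14
    {d : ℕ} (hd : 1 ≤ d)
    {Ω : Type*} [mΩ : MeasurableSpace Ω] (P : Measure Ω) [IsProbabilityMeasure P]
    (K : Matrix (Fin d) (Fin d) ℝ) (hK : K.PosDef)
    (A : Ω → Matrix (Fin d) (Fin d) ℝ) (hA : ∀ ω, (A ω).PosSemidef)
    (hAmeas : Measurable fun ω i j => A ω i j)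
    (hA8 : Integrable (fun ω => hsNorm (A ω) ^ 8) P)
    (G : Ω → Fin d → ℝ) (hG : Measure.map G P = gaussLaw K)
    (hInd : IndepFun G (fun ω i j => A ω i j) P)
    (hPE : 0 < P (EvSet A K))
    (η : ℝ) (hη : η ∈ Set.Icc (0 : ℝ) 1)
    (i j : ℕ) (hi : i ∈ ({1, 2, 3} : Set ℕ)) (hj : j ∈ ({1, 2, 3} : Set ℕ))
    (k : ℕ) (hk : 1 ≤ k) :
    (P (EvSet A K)).toReal *
      ∫ ω, (gtilde P A K η (G ω) ^ k)⁻¹ *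
        iteratedDeriv i (fun s => gtilde P A K s (G ω)) η *
        iteratedDeriv j (fun s => gtilde P A K s (G ω)) η ^ k ∂P ≤
      Real.sqrt (∫ ω in EvSet A K,
          hfun i (A ω) K η (G ω) ^ 2 * gfun (A ω) K η (G ω) ∂P) *
      Real.sqrt (∫ ω in EvSet A K,
          hfun j (A ω) K η (G ω) ^ (2 * k) * gfun (A ω) K η (G ω) ∂P) := by
  
  obtain ⟨A', hA'⟩ : ∃ A' : Ω → Fin d → Fin d → ℝ, A' = fun ω i j => A ω i j := ⟨_, rfl⟩
  have hAA : ∀ ω, A ω = Matrix.of (A' ω) := by intro ω; rw [hA']; rfl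
  have hEv : EvSet A K = A' ⁻¹' goodSet K := by rw [hA']; exact evSet_eq hd K A hA
  rw [← hA'] at hAmeas hInd
  have hE : MeasurableSet (A' ⁻¹' goodSet K) := hAmeas (isClosed_goodSet K).measurableSet
  unfold gtilde
  rw [hEv] at hPE
  simp only [hEv, hAA]
  set E := A' ⁻¹' goodSet K with hEdef
  set c : ℝ := (P E).toReal with hc
  have hc0 : 0 < c := ENNReal.toReal_pos hPE.ne' (measure_ne_top _ _)
  have hηo : η ∈ Set.Ioo (-1/2 : ℝ) (3/2) := ⟨by linarith [hη.1], by linarith [hη.2]⟩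
  have hηc : η ∈ Set.Icc (-1/2 : ℝ) (3/2) := Set.Ioo_subset_Icc_self hηo
  have hAQ : ∀ᵐ ω ∂(P.restrict E), A' ω ∈ goodSet K := ae_restrict_mem hE
  obtain ⟨p, hp, hpd, hpI⟩ := integral_iteratedDeriv hd hK (P.restrict E) A' hAmeas hAQ i
  obtain ⟨q, hq, hqd, hqI⟩ := integral_iteratedDeriv hd hK (P.restrict E) A' hAmeas hAQ j
  have hφp : ∀ x, 0 < gaussDensity K x := gaussDensity_pos hK.det_pos
  have hdet : ∀ ω ∈ E, 0 < (Gam (Matrix.of (A' ω)) K η).det := fun ω hω =>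
    (gam_posDef hd K hK hω hηc).det_pos
  -- right-hand sides
  have hR : ∀ (n m : ℕ) (r : (Fin d → Fin d → ℝ) → ℝ → (Fin d → ℝ) → ℝ),
      (∀ M t x, 0 < (Gam (Matrix.of M) K t).det →
      iteratedDeriv n (fun s => gaussDensity (Gam (Matrix.of M) K s) x) t
      = r M t x * gaussDensity (Gam (Matrix.of M) K t) x) →
      ∫ ω in E, hfun n (Matrix.of (A' ω)) K η (G ω) ^ m * gfun (Matrix.of (A' ω)) K η (G ω) ∂P
      = ∫ ω in E, r (A' ω) η (G ω) ^ m * (gaussDensity (Gam (Matrix.of (A' ω)) K η) (G ω) /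
        gaussDensity K (G ω)) ∂P := by
    intro n m r hr
    refine setIntegral_congr_fun hE fun ω hω => ?_
    have h1 := hdet ω hω
    have h2 := gaussDensity_pos h1 (G ω)
    have h3 := hφp (G ω)
    simp only [hfun, gfun]
    rw [iteratedDeriv_div_const, hr _ _ _ h1]
    congr 2
    field_simp
  rw [hR i 2 p hpd, hR j (2 * k) q hqd]
  obtain ⟨hUi, hUe⟩ := independence_key hd P hK A' hAmeas G hG hInd hηc (hp.pow 2)
  obtain ⟨hVi, hVe⟩ := independence_key hd P hK A' hAmeas G hG hInd hηc (hq.pow (2 * k))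
  rw [← hUe, ← hVe]
  have hnn : ∀ (r : (Fin d → Fin d → ℝ) → ℝ → (Fin d → ℝ) → ℝ) (m : ℕ), Even m → ∀ x,
      0 ≤ ∫ ω in E, r (A' ω) η x ^ m * (gaussDensity (Gam (Matrix.of (A' ω)) K η) x /
        gaussDensity K x) ∂P := by
    intro r m hm x
    refine setIntegral_nonneg hE fun ω hω => ?_
    have h2 := gaussDensity_pos (hdet ω hω) x
    have h3 := hφp x
    have := hm.pow_nonneg (r (A' ω) η x)
    positivity
  have hek : Even (2 * k) := even_two_mul k
  obtain ⟨hIcs, hle⟩ := cs_sqrt P (fun ω => hnn p 2 even_two (G ω)) (fun ω => hnn q _ hek (G ω))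
    hUi hVi
  refine le_trans ?_ hle
  -- integrability at fixed x
  have hIx : ∀ {r : (Fin d → Fin d → ℝ) → ℝ → (Fin d → ℝ) → ℝ}, Nice K r → ∀ x,
      Integrable (fun ω => r (A' ω) η x * gaussDensity (Gam (Matrix.of (A' ω)) K η) x)
        (P.restrict E) := by
    intro r hr x
    obtain ⟨B, -, -, hB⟩ := hr.dominated hd hK
    have e : Measurable (fun ω => (A' ω, η, x)) := by fun_prop
    refine Integrable.mono' (integrable_const (B x))
      ((hr.measurable.mul measurable_density).comp e).aestronglyMeasurable ?_
    filter_upwards [hAQ] with ω hω using hB _ hω η hηc x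
  -- pointwise bound
  have hpt : ∀ x, c * ((((∫ ω in E, gaussDensity (Gam (Matrix.of (A' ω)) K η) x ∂P) /
        (c * gaussDensity K x)) ^ k)⁻¹ *
      iteratedDeriv i (fun s => (∫ ω in E, gaussDensity (Gam (Matrix.of (A' ω)) K s) x ∂P) /
        (c * gaussDensity K x)) η *
      iteratedDeriv j (fun s => (∫ ω in E, gaussDensity (Gam (Matrix.of (A' ω)) K s) x ∂P) /
        (c * gaussDensity K x)) η ^ k) ≤
      Real.sqrt (∫ ω in E, p (A' ω) η x ^ 2 * (gaussDensity (Gam (Matrix.of (A' ω)) K η) x /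
        gaussDensity K x) ∂P) *
      Real.sqrt (∫ ω in E, q (A' ω) η x ^ (2 * k) *
        (gaussDensity (Gam (Matrix.of (A' ω)) K η) x / gaussDensity K x) ∂P) := by
    intro x
    have hw : Integrable (fun ω => gaussDensity (Gam (Matrix.of (A' ω)) K η) x)
        (P.restrict E) := by simpa using hIx (Nice.const 1) x
    have hw0 : ∀ᵐ ω ∂(P.restrict E), 0 ≤ gaussDensity (Gam (Matrix.of (A' ω)) K η) x := by
      filter_upwards [hAQ] with ω hω using (gaussDensity_pos (hdet ω hω) x).le
    have hW : 0 < ∫ ω in E, gaussDensity (Gam (Matrix.of (A' ω)) K η) x ∂P := by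
      rw [integral_pos_iff_support_of_nonneg_ae hw0 hw]
      refine lt_of_lt_of_le hPE ?_
      rw [← Measure.restrict_apply_self P E]
      exact measure_mono fun ω hω => (gaussDensity_pos (hdet ω hω) x).ne'
    have hJ1 := jensen_pow (P.restrict E) even_two hw0 hw (hIx hp x) (hIx (hp.pow 2) x) hW
    have hJ2 := jensen_pow (P.restrict E) hek hw0 hw (hIx hq x) (hIx (hq.pow (2 * k)) x) hW
    rw [iteratedDeriv_div_const, iteratedDeriv_div_const, hpI x η hηo, hqI x η hηo]
    simp only [← mul_div_assoc, integral_div]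
    have hφ := hφp x
    set W := ∫ ω in E, gaussDensity (Gam (Matrix.of (A' ω)) K η) x ∂P
    set I := ∫ ω in E, p (A' ω) η x * gaussDensity (Gam (Matrix.of (A' ω)) K η) x ∂P
    set J := ∫ ω in E, q (A' ω) η x * gaussDensity (Gam (Matrix.of (A' ω)) K η) x ∂P
    set U := ∫ ω in E, p (A' ω) η x ^ 2 * gaussDensity (Gam (Matrix.of (A' ω)) K η) x ∂P
    set V := ∫ ω in E, q (A' ω) η x ^ (2 * k) * gaussDensity (Gam (Matrix.of (A' ω)) K η) x ∂P
    set φ := gaussDensity K x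
    have hU0 : 0 ≤ U := le_trans (by positivity) hJ1
    have hV0 : 0 ≤ V := le_trans (mul_nonneg (hek.pow_nonneg _) hW.le) hJ2
    have hI : I = (I / W) * W := by field_simp
    have hJ : J = (J / W) * W := by field_simp
    set a := I / W
    set b := J / W
    have hEq : c * (((W / (c * φ)) ^ k)⁻¹ * (I / (c * φ)) * (J / (c * φ)) ^ k)
        = W * (a * b ^ k) / φ := by
      rw [hI, hJ]
      have : (b * W / (c * φ)) ^ k = b ^ k * (W / (c * φ)) ^ k := by
        rw [← mul_pow, mul_div_assoc]
      rw [this]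
      have h0 : (W / (c * φ)) ^ k ≠ 0 := by positivity
      generalize (W / (c * φ)) ^ k = Z at *
      field_simp
    rw [mul_div_assoc _ I, hEq, ← Real.sqrt_mul (by positivity)]
    refine Real.le_sqrt_of_sq_le ?_
    have h5 : (a ^ 2 * W) * (b ^ (2 * k) * W) ≤ U * V :=
      mul_le_mul hJ1 hJ2 (mul_nonneg (hek.pow_nonneg _) hW.le) hU0
    have h6 : (W * (a * b ^ k) / φ) ^ 2 = (a ^ 2 * W) * (b ^ (2 * k) * W) / φ ^ 2 := by
      rw [pow_mul']; ring
    rw [h6, div_mul_div_comm, ← sq]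
    gcongr
  rw [← integral_const_mul]
  by_cases hF : Integrable (fun ω => c * ((((∫ ω' in E,
        gaussDensity (Gam (Matrix.of (A' ω')) K η) (G ω) ∂P) /
        (c * gaussDensity K (G ω))) ^ k)⁻¹ *
      iteratedDeriv i (fun s => (∫ ω' in E, gaussDensity (Gam (Matrix.of (A' ω')) K s) (G ω) ∂P) /
        (c * gaussDensity K (G ω))) η *
      iteratedDeriv j (fun s => (∫ ω' in E, gaussDensity (Gam (Matrix.of (A' ω')) K s) (G ω) ∂P) /
        (c * gaussDensity K (G ω))) η ^ k)) P
  · exact integral_mono hF hIcs fun ω => hpt (G ω)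
  · rw [integral_undef hF]
    exact integral_nonneg fun ω => by positivity
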